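/- arXiv:2210.14878 — 2 statements merged into one kernel-verified Lean document; each statement's English description precedes it below -/
import Mathlib

section
/- Suppose the pair (A, H) is observable. Then for every α > 0, the sublevel set S_α = {L ∈ S : J(L) ≤ α} is a compact subset of the space of n×m real matrices. -/
open Matrix Filter Topology

/-- Spectral radius of a real square matrix: the maximum modulus of its complex
eigenvalues. -/
noncomputable def specRad {n : ℕ} (M : Matrix (Fin n) (Fin n) ℝ) : ENNReal :=
  spectralRadius ℂ (M.map (Complex.ofReal))

section Frobenius

open scoped Matrix.Norms.Frobenius

section TraceForm

variable {ι κ : Type*} [Fintype ι] [Fintype κ]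

theorem Matrix.frobenius_norm_sq_eq_trace (B : Matrix ι κ ℝ) :
    ‖B‖ ^ 2 = (Bᵀ * B).trace := by
  rw [frobenius_norm_def, ← Real.sqrt_eq_rpow, Real.sq_sqrt (by positivity), Finset.sum_comm]
  simp [trace, mul_apply, pow_two]

theorem Matrix.PosSemidef.trace_mul_mul_transpose_nonneg {P : Matrix κ κ ℝ} (hP : P.PosSemidef)
    (B : Matrix ι κ ℝ) : 0 ≤ (B * P * Bᵀ).trace := by
  have h := hP.mul_mul_conjTranspose_same B
  rw [conjTranspose_eq_transpose_of_trivial] at h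
  exact h.trace_nonneg

open scoped MatrixOrder in
theorem Matrix.PosDef.exists_norm_sq_le_trace {P : Matrix κ κ ℝ} (hP : P.PosDef) :
    ∃ K : ℝ, 0 ≤ K ∧ ∀ B : Matrix ι κ ℝ, ‖B‖ ^ 2 ≤ K * (B * P * Bᵀ).trace := by
  classical
  obtain ⟨C, hC⟩ := CStarAlgebra.nonneg_iff_eq_star_mul_self.mp hP.posSemidef.nonneg
  rw [star_eq_conjTranspose, conjTranspose_eq_transpose_of_trivial] at hC
  have hdet : IsUnit C.det := by
    have := (isUnit_iff_isUnit_det P).mp hP.isUnit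
    rw [hC, det_mul] at this
    exact isUnit_of_mul_isUnit_right this
  refine ⟨‖C⁻¹‖ ^ 2, by positivity, fun B => ?_⟩
  have htr : (B * P * Bᵀ).trace = ‖C * Bᵀ‖ ^ 2 := by
    rw [frobenius_norm_sq_eq_trace, hC]
    simp [Matrix.mul_assoc]
  rw [htr, ← mul_pow]
  gcongr
  calc ‖B‖ = ‖C⁻¹ * (C * Bᵀ)‖ := by
        rw [← Matrix.mul_assoc, nonsing_inv_mul _ hdet, Matrix.one_mul, frobenius_norm_transpose]
    _ ≤ _ := frobenius_norm_mul _ _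

end TraceForm

section SpectralRadius

variable {n : ℕ}

theorem exists_norm_pow_le_of_specRad_lt_one {M : Matrix (Fin n) (Fin n) ℝ}
    (hM : specRad M < 1) :
    ∃ r : ℝ, 0 ≤ r ∧ r < 1 ∧ ∀ᶠ t : ℕ in atTop, ‖M ^ t‖ ≤ r ^ t := by
  have : CompleteSpace (Matrix (Fin n) (Fin n) ℂ) := FiniteDimensional.complete ℂ _
  obtain ⟨r, hr, hr1⟩ := ENNReal.lt_iff_exists_nnreal_btwn.mp hM
  refine ⟨r, r.2, by exact_mod_cast hr1, ?_⟩
  have h := spectrum.pow_nnnorm_pow_one_div_tendsto_nhds_spectralRadius (M.map Complex.ofReal)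
  filter_upwards [h.eventually_lt_const hr, eventually_gt_atTop 0] with t ht ht0
  have ht' : (0 : ℝ) < t := by exact_mod_cast ht0
  rw [one_div, ENNReal.rpow_inv_lt_iff ht', ENNReal.rpow_natCast] at ht
  have hmap : (M.map Complex.ofReal) ^ t = (M ^ t).map Complex.ofReal :=
    (map_pow (Complex.ofRealHom.mapMatrix) M t).symm
  have hnorm : ‖(M ^ t).map Complex.ofReal‖ = ‖M ^ t‖ :=
    frobenius_norm_map_eq _ _ fun a => Complex.norm_real a
  rw [← hnorm, ← hmap]
  exact_mod_cast ht.le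

theorem summable_lyapunov_of_specRad_lt_one {M : Matrix (Fin n) (Fin n) ℝ}
    (hM : specRad M < 1) (W : Matrix (Fin n) (Fin n) ℝ) :
    Summable fun t : ℕ => M ^ t * W * Mᵀ ^ t := by
  have : CompleteSpace (Matrix (Fin n) (Fin n) ℝ) := FiniteDimensional.complete ℝ _
  obtain ⟨r, hr0, hr1, hr⟩ := exists_norm_pow_le_of_specRad_lt_one hM
  have hgeom : Summable fun t : ℕ => ‖W‖ * (r ^ 2) ^ t :=
    (summable_geometric_of_lt_one (by positivity) (by nlinarith)).mul_left _
  refine Summable.of_norm_bounded_eventually_nat hgeom ?_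
  filter_upwards [hr] with t ht
  calc ‖M ^ t * W * Mᵀ ^ t‖ ≤ ‖M ^ t‖ * ‖W‖ * ‖Mᵀ ^ t‖ :=
        (frobenius_norm_mul _ _).trans (by gcongr; exact frobenius_norm_mul _ _)
    _ = ‖M ^ t‖ * ‖W‖ * ‖M ^ t‖ := by rw [← transpose_pow, frobenius_norm_transpose]
    _ ≤ r ^ t * ‖W‖ * r ^ t := by gcongr
    _ = ‖W‖ * (r ^ 2) ^ t := by ring

theorem specRad_lt_one_of_forall_eigenvector (hn : 0 < n) (M : Matrix (Fin n) (Fin n) ℝ)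
    (h : ∀ (z : ℂ) (v : Fin n → ℂ), M.map Complex.ofReal *ᵥ v = z • v → 1 ≤ ‖z‖ → v = 0) :
    specRad M < 1 := by
  have : CompleteSpace (Matrix (Fin n) (Fin n) ℂ) := FiniteDimensional.complete ℂ _
  have : Nonempty (Fin n) := ⟨⟨0, hn⟩⟩
  refine spectrum.spectralRadius_lt_of_forall_lt (M.map Complex.ofReal) (r := 1) fun z hz => ?_
  rw [spectrum.mem_iff, isUnit_iff_isUnit_det, isUnit_iff_ne_zero, not_not,
    ← exists_mulVec_eq_zero_iff] at hz
  obtain ⟨v, hv0, hv⟩ := hz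
  by_contra! hz1
  refine hv0 (h z v ?_ (by exact_mod_cast hz1))
  rw [sub_mulVec, sub_eq_zero, Algebra.algebraMap_eq_smul_one, smul_mulVec, one_mulVec] at hv
  exact hv.symm

end SpectralRadius

section Observability

variable {n m : ℕ} {A : Matrix (Fin n) (Fin n) ℝ} {H : Matrix (Fin m) (Fin n) ℝ}

theorem map_ofReal_pow_mulVec_of_eigenvector {M : Matrix (Fin n) (Fin n) ℝ} {z : ℂ}
    {v : Fin n → ℂ} (hv : M.map Complex.ofReal *ᵥ v = z • v) (t : ℕ) :
    (M ^ t).map Complex.ofReal *ᵥ v = z ^ t • v := by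
  have hmap : (M ^ t).map Complex.ofReal = (M.map Complex.ofReal) ^ t :=
    map_pow (Complex.ofRealHom.mapMatrix) M t
  rw [hmap]
  induction t with
  | zero => simp
  | succ k ih =>
    rw [pow_succ, ← mulVec_mulVec, hv, mulVec_smul, ih (map_pow (Complex.ofRealHom.mapMatrix) M k),
      smul_smul, pow_succ, mul_comm]

theorem complex_observable
    (hObs : ∀ v : Fin n → ℝ, (∀ t : ℕ, t ≤ n - 1 → H *ᵥ (A ^ t *ᵥ v) = 0) → v = 0)
    (v : Fin n → ℂ)
    (hv : ∀ t : ℕ, H.map Complex.ofReal *ᵥ ((A ^ t).map Complex.ofReal *ᵥ v) = 0) : v = 0 := by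
  have key : ∀ f : ℂ →ₗ[ℝ] ℝ, (fun i => f (v i)) = 0 := by
    intro f
    have hf : ∀ {p q : ℕ} (B : Matrix (Fin p) (Fin q) ℝ) (w : Fin q → ℂ),
        B *ᵥ (fun i => f (w i)) = fun i => f ((B.map Complex.ofReal *ᵥ w) i) := by
      intro p q B w
      ext i
      simp only [mulVec, dotProduct, map_sum, map_apply]
      refine Finset.sum_congr rfl fun j _ => ?_
      rw [← Complex.real_smul, map_smul, smul_eq_mul]
    refine hObs _ fun t _ => ?_
    rw [hf, hf, hv t]
    ext i
    simp
  ext i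
  exact Complex.ext (congrFun (key Complex.reLm) i) (congrFun (key Complex.imLm) i)

theorem specRad_lt_one_of_tendsto_output (hn : 0 < n)
    (hObs : ∀ v : Fin n → ℝ, (∀ t : ℕ, t ≤ n - 1 → H *ᵥ (A ^ t *ᵥ v) = 0) → v = 0)
    (L : Matrix (Fin n) (Fin m) ℝ)
    (h : Tendsto (fun t : ℕ => H * (A - L * H) ^ t) atTop (𝓝 0)) :
    specRad (A - L * H) < 1 := by
  refine specRad_lt_one_of_forall_eigenvector hn _ fun z v hv hz => ?_
  have hmul : ∀ {p q r : ℕ} (B : Matrix (Fin p) (Fin q) ℝ) (C : Matrix (Fin q) (Fin r) ℝ),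
      (B * C).map Complex.ofReal = B.map Complex.ofReal * C.map Complex.ofReal :=
    fun B C => Matrix.map_mul (f := Complex.ofRealHom)
  have hHv : H.map Complex.ofReal *ᵥ v = 0 := by
    have hcont : Continuous fun B : Matrix (Fin m) (Fin n) ℝ => B.map Complex.ofReal *ᵥ v :=
      (continuous_id.matrix_map Complex.continuous_ofReal).matrix_mulVec continuous_const
    have hlim := (hcont.tendsto 0).comp h
    have hzero : (0 : Matrix (Fin m) (Fin n) ℝ).map Complex.ofReal *ᵥ v = 0 := by simp
    rw [hzero] at hlim
    refine norm_le_zero_iff.mp (ge_of_tendsto' (by simpa using hlim.norm) fun t => ?_)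
    rw [hmul, ← mulVec_mulVec, map_ofReal_pow_mulVec_of_eigenvector hv,
      mulVec_smul, norm_smul, norm_pow]
    exact le_mul_of_one_le_left (norm_nonneg _) (one_le_pow₀ hz)
  have hAv : A.map Complex.ofReal *ᵥ v = z • v := by
    have hsub : (A - L * H).map Complex.ofReal
        = A.map Complex.ofReal - L.map Complex.ofReal * H.map Complex.ofReal := by
      rw [← hmul]
      exact Matrix.map_sub (f := Complex.ofReal) Complex.ofReal_sub _ _
    rw [← hv, hsub, sub_mulVec, ← mulVec_mulVec, hHv, mulVec_zero, sub_zero]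
  refine complex_observable hObs v fun t => ?_
  rw [map_ofReal_pow_mulVec_of_eigenvector hAv, mulVec_smul, hHv, smul_zero]


end Observability

section StageCost

variable {n m : ℕ} {A : Matrix (Fin n) (Fin n) ℝ} {H : Matrix (Fin m) (Fin n) ℝ}
  {Q : Matrix (Fin n) (Fin n) ℝ} {R : Matrix (Fin m) (Fin m) ℝ}

/-- The contribution of time `t` to `tr (X(L) Hᵀ H)`. -/
def stageCost (A : Matrix (Fin n) (Fin n) ℝ) (H : Matrix (Fin m) (Fin n) ℝ)
    (Q : Matrix (Fin n) (Fin n) ℝ) (R : Matrix (Fin m) (Fin m) ℝ)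
    (L : Matrix (Fin n) (Fin m) ℝ) (t : ℕ) : ℝ :=
  ((A - L * H) ^ t * (Q + L * R * Lᵀ) * ((A - L * H)ᵀ) ^ t * Hᵀ * H).trace

theorem stageCost_eq (L : Matrix (Fin n) (Fin m) ℝ) (t : ℕ) :
    stageCost A H Q R L t =
      (H * (A - L * H) ^ t * Q * (H * (A - L * H) ^ t)ᵀ).trace +
      (H * (A - L * H) ^ t * L * R * (H * (A - L * H) ^ t * L)ᵀ).trace := by
  rw [stageCost, trace_mul_comm, ← trace_add]
  simp only [transpose_mul, transpose_pow, Matrix.mul_assoc, Matrix.mul_add, Matrix.add_mul]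

theorem stageCost_nonneg (hQ : Q.PosDef) (hR : R.PosDef) (L : Matrix (Fin n) (Fin m) ℝ) (t : ℕ) :
    0 ≤ stageCost A H Q R L t := by
  rw [stageCost_eq]
  exact add_nonneg (hQ.posSemidef.trace_mul_mul_transpose_nonneg _)
    (hR.posSemidef.trace_mul_mul_transpose_nonneg _)

theorem continuous_stageCost (t : ℕ) : Continuous fun L => stageCost A H Q R L t := by
  unfold stageCost
  fun_prop

theorem norm_output_sq_le_stageCost (hQ : Q.PosDef) (hR : R.PosDef) :
    ∃ K : ℝ, 0 ≤ K ∧ ∀ (L : Matrix (Fin n) (Fin m) ℝ) (t : ℕ),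
      ‖H * (A - L * H) ^ t‖ ^ 2 ≤ K * stageCost A H Q R L t := by
  obtain ⟨K, hK0, hK⟩ := hQ.exists_norm_sq_le_trace (ι := Fin m)
  refine ⟨K, hK0, fun L t => (hK _).trans ?_⟩
  rw [stageCost_eq]
  gcongr
  exact le_add_of_nonneg_right (hR.posSemidef.trace_mul_mul_transpose_nonneg _)

theorem norm_output_gain_sq_le_stageCost (hQ : Q.PosDef) (hR : R.PosDef) :
    ∃ K : ℝ, 0 ≤ K ∧ ∀ (L : Matrix (Fin n) (Fin m) ℝ) (t : ℕ),
      ‖H * (A - L * H) ^ t * L‖ ^ 2 ≤ K * stageCost A H Q R L t := by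
  obtain ⟨K, hK0, hK⟩ := hR.exists_norm_sq_le_trace (ι := Fin m)
  refine ⟨K, hK0, fun L t => (hK _).trans ?_⟩
  rw [stageCost_eq]
  gcongr
  exact le_add_of_nonneg_left (hQ.posSemidef.trace_mul_mul_transpose_nonneg _)

theorem hasSum_stageCost {L : Matrix (Fin n) (Fin m) ℝ} (hL : specRad (A - L * H) < 1) :
    HasSum (stageCost A H Q R L)
      ((∑' t : ℕ, (A - L * H) ^ t * (Q + L * R * Lᵀ) * ((A - L * H)ᵀ) ^ t) * Hᵀ * H).trace := by
  have hcont : Continuous fun B : Matrix (Fin n) (Fin n) ℝ => (B * Hᵀ * H).trace := by fun_prop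
  refine (summable_lyapunov_of_specRad_lt_one hL _).hasSum.map
    ((traceAddMonoidHom (Fin n) ℝ).comp
      ((addMonoidHomMulRight H).comp (addMonoidHomMulRight Hᵀ))) hcont

theorem specRad_lt_one_of_summable_stageCost (hn : 0 < n)
    (hObs : ∀ v : Fin n → ℝ, (∀ t : ℕ, t ≤ n - 1 → H *ᵥ (A ^ t *ᵥ v) = 0) → v = 0)
    (hQ : Q.PosDef) (hR : R.PosDef) {L : Matrix (Fin n) (Fin m) ℝ}
    (h : Summable (stageCost A H Q R L)) : specRad (A - L * H) < 1 := by
  obtain ⟨K, -, hK⟩ := norm_output_sq_le_stageCost (A := A) (H := H) hQ hR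
  refine specRad_lt_one_of_tendsto_output hn hObs L (tendsto_zero_iff_norm_tendsto_zero.mpr ?_)
  have hsq : Tendsto (fun t : ℕ => ‖H * (A - L * H) ^ t‖ ^ 2) atTop (𝓝 0) :=
    squeeze_zero (fun _ => by positivity) (hK L) (by simpa using h.tendsto_atTop_zero.const_mul K)
  simpa using hsq.sqrt

/-- The gain enters every Markov parameter `H Aᵗ L` through the bounded closed-loop ones. -/
theorem exists_norm_markov_le {T : Set (Matrix (Fin n) (Fin m) ℝ)} {C : ℝ}
    (hT : ∀ L ∈ T, ∀ s : ℕ, ‖H * (A - L * H) ^ s * L‖ ≤ C) (t : ℕ) :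
    ∃ C' : ℝ, ∀ L ∈ T, ∀ s : ℕ, ‖H * (A - L * H) ^ s * A ^ t * L‖ ≤ C' := by
  induction t with
  | zero => exact ⟨C, by simpa using hT⟩
  | succ t ih =>
    obtain ⟨C', hC'⟩ := ih
    refine ⟨C' + C * C', fun L hL s => ?_⟩
    have hsplit : H * (A - L * H) ^ s * A ^ (t + 1) * L
        = H * (A - L * H) ^ (s + 1) * A ^ t * L
          + H * (A - L * H) ^ s * L * (H * (A - L * H) ^ 0 * A ^ t * L) := by
      rw [pow_succ (A - L * H), pow_succ' A]
      simp only [pow_zero, Matrix.mul_one, Matrix.mul_sub, Matrix.sub_mul, Matrix.mul_assoc]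
      abel
    have hC : 0 ≤ C := (norm_nonneg _).trans (hT L hL 0)
    rw [hsplit]
    refine (norm_add_le _ _).trans (add_le_add (hC' L hL _) ((frobenius_norm_mul _ _).trans ?_))
    exact mul_le_mul (hT L hL s) (hC' L hL 0) (norm_nonneg _) hC

theorem exists_isCompact_superset_of_norm_output_gain_le
    (hObs : ∀ v : Fin n → ℝ, (∀ t : ℕ, t ≤ n - 1 → H *ᵥ (A ^ t *ᵥ v) = 0) → v = 0)
    {T : Set (Matrix (Fin n) (Fin m) ℝ)} {C : ℝ}
    (hT : ∀ L ∈ T, ∀ s : ℕ, ‖H * (A - L * H) ^ s * L‖ ≤ C) :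
    ∃ T' : Set (Matrix (Fin n) (Fin m) ℝ), IsCompact T' ∧ T ⊆ T' := by
  have : ProperSpace (Matrix (Fin m) (Fin m) ℝ) := FiniteDimensional.proper ℝ _
  choose C' hC' using exists_norm_markov_le hT
  let Φ : Matrix (Fin n) (Fin m) ℝ →ₗ[ℝ] (Fin n → Matrix (Fin m) (Fin m) ℝ) :=
    LinearMap.pi fun t => mulLeftLinearMap (Fin m) ℝ (H * A ^ (t : ℕ))
  have hΦ : LinearMap.ker Φ = ⊥ := by
    refine LinearMap.ker_eq_bot'.mpr fun L hL => ?_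
    have hcol : ∀ j, L.col j = 0 := fun j => hObs _ fun t ht => by
      rcases Nat.eq_zero_or_pos n with rfl | hn
      · simp [Subsingleton.elim (L.col j) 0]
      have hLt : H * A ^ t * L = 0 := congrFun hL ⟨t, by omega⟩
      ext i
      rw [mulVec_mulVec]
      exact congrFun (congrFun hLt i) j
    ext i j
    exact congrFun (hcol j) i
  refine ⟨Φ ⁻¹' Set.univ.pi fun t => Metric.closedBall 0 (C' t),
    (LinearMap.isClosedEmbedding_of_injective hΦ).isCompact_preimage
      (isCompact_univ_pi fun t => isCompact_closedBall 0 (C' t)), fun L hL t _ => ?_⟩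
  rw [mem_closedBall_zero_iff]
  simpa [Φ, Matrix.mul_assoc] using hC' t L hL 0

end StageCost

end Frobenius

theorem isCompact_setOf_sum_stageCost_le {n m : ℕ} {A : Matrix (Fin n) (Fin n) ℝ}
    {H : Matrix (Fin m) (Fin n) ℝ} {Q : Matrix (Fin n) (Fin n) ℝ} {R : Matrix (Fin m) (Fin m) ℝ}
    (hObs : ∀ v : Fin n → ℝ, (∀ t : ℕ, t ≤ n - 1 → H *ᵥ (A ^ t *ᵥ v) = 0) → v = 0)
    (hQ : Q.PosDef) (hR : R.PosDef) (c : ℝ) :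
    IsCompact {L | ∀ N : ℕ, ∑ t ∈ Finset.range N, stageCost A H Q R L t ≤ c} := by
  obtain ⟨K, hK0, hK⟩ := norm_output_gain_sq_le_stageCost (A := A) (H := H) hQ hR
  obtain ⟨T', hT', hsub⟩ := exists_isCompact_superset_of_norm_output_gain_le (A := A) (H := H)
    (T := {L | ∀ N : ℕ, ∑ t ∈ Finset.range N, stageCost A H Q R L t ≤ c}) (C := √(K * c)) hObs
    fun L hL s => Real.le_sqrt_of_sq_le <| (hK L s).trans <| mul_le_mul_of_nonneg_left
      ((Finset.single_le_sum (fun t _ => stageCost_nonneg hQ hR L t)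
        (Finset.self_mem_range_succ s)).trans (hL (s + 1))) hK0
  refine hT'.of_isClosed_subset ?_ hsub
  simp only [Set.ofPred_forall]
  exact isClosed_iInter fun N => isClosed_le
    (continuous_finsetSum _ fun t _ => continuous_stageCost t) continuous_const

theorem stmt_3 {n m : ℕ} (hn : 0 < n) (hm : 0 < m)
    (A : Matrix (Fin n) (Fin n) ℝ) (H : Matrix (Fin m) (Fin n) ℝ)
    (Q : Matrix (Fin n) (Fin n) ℝ) (R : Matrix (Fin m) (Fin m) ℝ)
    (hQ : Q.PosDef) (hR : R.PosDef)
    (hObs : ∀ v : Fin n → ℝ,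
      (∀ t : ℕ, t ≤ n - 1 → H.mulVec ((A ^ t).mulVec v) = 0) → v = 0)
    (S : Set (Matrix (Fin n) (Fin m) ℝ))
    (hS : S = {L | specRad (A - L * H) < 1})
    (X : Matrix (Fin n) (Fin m) ℝ → Matrix (Fin n) (Fin n) ℝ)
    (hX : ∀ L, X L = ∑' t : ℕ, (A - L * H) ^ t * (Q + L * R * Lᵀ) * ((A - L * H)ᵀ) ^ t)
    (J : Matrix (Fin n) (Fin m) ℝ → ℝ)
    (hJ : ∀ L, J L = Matrix.trace (X L * Hᵀ * H) + Matrix.trace R)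
    (α : ℝ) (hα : 0 < α) :
    IsCompact {L | L ∈ S ∧ J L ≤ α} := by
  have hset : {L | L ∈ S ∧ J L ≤ α}
      = {L | ∀ N : ℕ, ∑ t ∈ Finset.range N, stageCost A H Q R L t ≤ α - R.trace} := by
    ext L
    simp only [hS, Set.mem_ofPred_eq]
    constructor
    · rintro ⟨hL, hJL⟩ N
      rw [hJ, hX] at hJL
      exact (sum_le_hasSum _ (fun t _ => stageCost_nonneg hQ hR L t) (hasSum_stageCost hL)).trans
        (le_sub_iff_add_le.mpr hJL)
    · intro hN
      have hL := specRad_lt_one_of_summable_stageCost hn hObs hQ hR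
        (summable_of_sum_range_le (stageCost_nonneg hQ hR L) hN)
      refine ⟨hL, ?_⟩
      rw [hJ, hX]
      exact le_sub_iff_add_le.mp (le_of_tendsto' (hasSum_stageCost hL).tendsto_sum_nat hN)
  rw [hset]
  exact isCompact_setOf_sum_stageCost_le hObs hQ hR _
end

section
/- Suppose L* ∈ S satisfies the first-order optimality condition L*·R = A_{L*}·X(L*)·Hᵀ, and write X* := X(L*). Then for every L ∈ S: (i) X(L) − X* − A_L·(X(L) − X*)·A_Lᵀ = (L − L*)·(R + H·X*·Hᵀ)·(L − L*)ᵀ, and (ii) J(L) − J(L*) = tr( Y(L) · (L − L*)·(R + H·X*·Hᵀ)·(L − L*)ᵀ ). -/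
open Matrix Filter Topology

section FrobeniusNorm

attribute [local instance] Matrix.frobeniusNormedAddCommGroup Matrix.frobeniusNormedSpace
  Matrix.frobeniusNormedRing Matrix.frobeniusNormedAlgebra

/-- The powers of a Schur-stable matrix are eventually dominated by a convergent geometric
sequence. -/
lemma exists_eventually_norm_pow_le {n : ℕ} {M : Matrix (Fin n) (Fin n) ℝ}
    (hM : specRad M < 1) :
    ∃ r : ℝ, 0 ≤ r ∧ r < 1 ∧ ∀ᶠ t : ℕ in atTop, ‖M ^ t‖ ≤ r ^ t := by
  obtain ⟨r, hr, hr1⟩ := ENNReal.lt_iff_exists_nnreal_btwn.1 hM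
  refine ⟨r, r.2, by exact_mod_cast hr1, ?_⟩
  have hlim := spectrum.pow_nnnorm_pow_one_div_tendsto_nhds_spectralRadius
    (M.map Complex.ofReal)
  filter_upwards [hlim.eventually_lt_const hr, eventually_gt_atTop 0] with t ht ht0
  have hpow : (M.map Complex.ofReal) ^ t = (M ^ t).map Complex.ofReal :=
    (Matrix.map_pow M Complex.ofRealHom t).symm
  have hnorm : ‖(M ^ t).map Complex.ofReal‖₊ = ‖M ^ t‖₊ :=
    Matrix.frobenius_nnnorm_map_eq _ _ fun a => by simp
  rw [hpow, hnorm, one_div] at ht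
  have hle : (‖M ^ t‖₊ : ENNReal) ≤ (r : ENNReal) ^ t := by
    have := ENNReal.rpow_le_rpow ht.le (Nat.cast_nonneg (α := ℝ) t)
    rwa [ENNReal.rpow_inv_rpow (by exact_mod_cast ht0.ne'), ENNReal.rpow_natCast] at this
  exact_mod_cast hle

lemma summable_pow_mul_mul_pow {n : ℕ} {P P' : Matrix (Fin n) (Fin n) ℝ} {r : ℝ}
    (hr0 : 0 ≤ r) (hr1 : r < 1) (hP : ∀ᶠ t : ℕ in atTop, ‖P ^ t‖ ≤ r ^ t)
    (hP' : ∀ᶠ t : ℕ in atTop, ‖P' ^ t‖ ≤ r ^ t) (N : Matrix (Fin n) (Fin n) ℝ) :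
    Summable fun t : ℕ => P ^ t * N * P' ^ t := by
  have hg : Summable fun t : ℕ => (r * r) ^ t * ‖N‖ :=
    (summable_geometric_of_lt_one (by positivity) (by nlinarith)).mul_right _
  refine hg.of_norm_bounded_eventually_nat ?_
  filter_upwards [hP, hP'] with t h h'
  calc ‖P ^ t * N * P' ^ t‖ ≤ ‖P ^ t‖ * ‖N‖ * ‖P' ^ t‖ :=
        (norm_mul_le _ _).trans (by gcongr; exact norm_mul_le _ _)
    _ ≤ r ^ t * ‖N‖ * r ^ t := by gcongr
    _ = (r * r) ^ t * ‖N‖ := by rw [mul_pow]; ring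

lemma summable_pow_mul_mul_transpose_pow {n : ℕ} {M : Matrix (Fin n) (Fin n) ℝ}
    (hM : specRad M < 1) (N : Matrix (Fin n) (Fin n) ℝ) :
    Summable fun t : ℕ => M ^ t * N * Mᵀ ^ t := by
  obtain ⟨r, hr0, hr1, h⟩ := exists_eventually_norm_pow_le hM
  refine summable_pow_mul_mul_pow hr0 hr1 h (h.mono fun t ht => ?_) N
  rwa [← Matrix.transpose_pow, Matrix.frobenius_norm_transpose]

lemma summable_transpose_pow_mul_mul_pow {n : ℕ} {M : Matrix (Fin n) (Fin n) ℝ}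
    (hM : specRad M < 1) (N : Matrix (Fin n) (Fin n) ℝ) :
    Summable fun t : ℕ => Mᵀ ^ t * N * M ^ t := by
  obtain ⟨r, hr0, hr1, h⟩ := exists_eventually_norm_pow_le hM
  refine summable_pow_mul_mul_pow hr0 hr1 (h.mono fun t ht => ?_) h N
  rwa [← Matrix.transpose_pow, Matrix.frobenius_norm_transpose]

end FrobeniusNorm

lemma tsum_pow_mul_mul_pow_eq {n : ℕ} {P P' N : Matrix (Fin n) (Fin n) ℝ}
    (h : Summable fun t : ℕ => P ^ t * N * P' ^ t) :
    ∑' t : ℕ, P ^ t * N * P' ^ t = P * (∑' t : ℕ, P ^ t * N * P' ^ t) * P' + N := by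
  have hstep : ∀ t : ℕ, P ^ (t + 1) * N * P' ^ (t + 1) = P * (P ^ t * N * P' ^ t) * P' := by
    intro t
    simp only [pow_succ' P, pow_succ P', Matrix.mul_assoc]
  conv_lhs => rw [h.tsum_eq_zero_add]
  simp only [hstep, pow_zero, Matrix.one_mul, Matrix.mul_one]
  rw [(h.mul_left P).tsum_mul_right, h.tsum_mul_left, add_comm]

lemma transpose_tsum_pow_mul_mul_transpose_pow {n : ℕ} {M N : Matrix (Fin n) (Fin n) ℝ}
    (hN : Nᵀ = N) :
    (∑' t : ℕ, M ^ t * N * Mᵀ ^ t)ᵀ = ∑' t : ℕ, M ^ t * N * Mᵀ ^ t := by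
  rw [Matrix.transpose_tsum]
  simp [Matrix.transpose_mul, Matrix.transpose_pow, hN, Matrix.mul_assoc]

/-- Duality between the Lyapunov operator `D ↦ D - M * D * Mᵀ` and the solution `Y` of the
adjoint Lyapunov equation. -/
lemma trace_mul_eq_of_lyapunov {n : ℕ} {M Y C D G : Matrix (Fin n) (Fin n) ℝ}
    (hY : Y = Mᵀ * Y * M + C) (hD : D - M * D * Mᵀ = G) :
    Matrix.trace (D * C) = Matrix.trace (Y * G) := by
  have hcyc : Matrix.trace (D * (Mᵀ * Y * M)) = Matrix.trace (Y * (M * D * Mᵀ)) := by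
    rw [Matrix.trace_mul_comm Y, ← Matrix.mul_assoc, Matrix.trace_mul_comm _ M]
    simp only [Matrix.mul_assoc]
  rw [← hD, Matrix.mul_sub, Matrix.trace_sub, ← hcyc, Matrix.trace_mul_comm Y,
    ← Matrix.trace_sub, ← Matrix.mul_sub]
  rw [← eq_sub_iff_add_eq'.2 hY.symm]

/-- Difference of two Lyapunov equations around a stationary gain. -/
lemma lyapunov_sub_eq {n m : ℕ} {A Q X Xs : Matrix (Fin n) (Fin n) ℝ}
    {H : Matrix (Fin m) (Fin n) ℝ} {R : Matrix (Fin m) (Fin m) ℝ}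
    {L Ls : Matrix (Fin n) (Fin m) ℝ} (hR : Rᵀ = R) (hXs : Xsᵀ = Xs)
    (hX : X = (A - L * H) * X * (A - L * H)ᵀ + (Q + L * R * Lᵀ))
    (hXs_eq : Xs = (A - Ls * H) * Xs * (A - Ls * H)ᵀ + (Q + Ls * R * Lsᵀ))
    (hopt : Ls * R = (A - Ls * H) * Xs * Hᵀ) :
    X - Xs - (A - L * H) * (X - Xs) * (A - L * H)ᵀ =
      (L - Ls) * (R + H * Xs * Hᵀ) * (L - Ls)ᵀ := by
  obtain ⟨E, rfl⟩ : ∃ E, L = Ls + E := ⟨L - Ls, by abel⟩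
  have hM : A - (Ls + E) * H = (A - Ls * H) - E * H := by rw [Matrix.add_mul]; abel
  rw [hM] at hX ⊢
  generalize A - Ls * H = M at *
  have hopt' : H * (Xs * Mᵀ) = R * Lsᵀ := by
    have := congrArg Matrix.transpose hopt
    simpa [Matrix.transpose_mul, hR, hXs, Matrix.mul_assoc] using this.symm
  have hXsub : X - (M - E * H) * X * (M - E * H)ᵀ = Q + (Ls + E) * R * (Ls + E)ᵀ :=
    sub_eq_iff_eq_add'.2 hX
  have hQ : Q = Xs - M * Xs * Mᵀ - Ls * R * Lsᵀ := by
    rw [eq_sub_iff_add_eq, eq_sub_iff_add_eq']; exact hXs_eq.symm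
  have hcross : M * (Xs * (Hᵀ * Eᵀ)) = Ls * (R * Eᵀ) := by
    rw [← Matrix.mul_assoc Ls, hopt]; simp only [Matrix.mul_assoc]
  have hsplit : X - Xs - (M - E * H) * (X - Xs) * (M - E * H)ᵀ =
      (X - (M - E * H) * X * (M - E * H)ᵀ) - Xs + (M - E * H) * Xs * (M - E * H)ᵀ := by
    rw [Matrix.mul_sub, Matrix.sub_mul]; abel
  rw [hsplit, hXsub, hQ, add_sub_cancel_left]
  simp only [Matrix.mul_add, Matrix.add_mul, Matrix.mul_sub, Matrix.sub_mul,
    Matrix.transpose_add, Matrix.transpose_sub, Matrix.transpose_mul, Matrix.mul_assoc,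
    hopt', hcross]
  abel

theorem stmt_10 {n m : ℕ} (hn : 0 < n) (hm : 0 < m)
    (A : Matrix (Fin n) (Fin n) ℝ) (H : Matrix (Fin m) (Fin n) ℝ)
    (Q : Matrix (Fin n) (Fin n) ℝ) (R : Matrix (Fin m) (Fin m) ℝ)
    (hQ : Q.PosDef) (hR : R.PosDef)
    (S : Set (Matrix (Fin n) (Fin m) ℝ))
    (hS : S = {L | specRad (A - L * H) < 1})
    (X : Matrix (Fin n) (Fin m) ℝ → Matrix (Fin n) (Fin n) ℝ)
    (hX : ∀ L, X L = ∑' t : ℕ, (A - L * H) ^ t * (Q + L * R * Lᵀ) * ((A - L * H)ᵀ) ^ t)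
    (Y : Matrix (Fin n) (Fin m) ℝ → Matrix (Fin n) (Fin n) ℝ)
    (hY : ∀ L, Y L = ∑' t : ℕ, ((A - L * H)ᵀ) ^ t * (Hᵀ * H) * (A - L * H) ^ t)
    (J : Matrix (Fin n) (Fin m) ℝ → ℝ)
    (hJ : ∀ L, J L = Matrix.trace (X L * Hᵀ * H) + Matrix.trace R)
    (Lstar : Matrix (Fin n) (Fin m) ℝ) (hLstarS : Lstar ∈ S)
    (hLstarOpt : Lstar * R = (A - Lstar * H) * X Lstar * Hᵀ)
    (L : Matrix (Fin n) (Fin m) ℝ) (hL : L ∈ S) :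
    (X L - X Lstar - (A - L * H) * (X L - X Lstar) * (A - L * H)ᵀ =
      (L - Lstar) * (R + H * X Lstar * Hᵀ) * (L - Lstar)ᵀ) ∧
    (J L - J Lstar =
      Matrix.trace (Y L * ((L - Lstar) * (R + H * X Lstar * Hᵀ) * (L - Lstar)ᵀ))) := by
  subst hS
  have hRt : Rᵀ = R := by simpa using hR.isHermitian.eq
  have hQt : Qᵀ = Q := by simpa using hQ.isHermitian.eq
  have hXeq : ∀ K, specRad (A - K * H) < 1 →
      X K = (A - K * H) * X K * (A - K * H)ᵀ + (Q + K * R * Kᵀ) := fun K hK => by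
    rw [hX]
    exact tsum_pow_mul_mul_pow_eq (summable_pow_mul_mul_transpose_pow hK _)
  have hYeq : Y L = (A - L * H)ᵀ * Y L * (A - L * H) + Hᵀ * H := by
    rw [hY]
    exact tsum_pow_mul_mul_pow_eq (summable_transpose_pow_mul_mul_pow hL _)
  have hXt : (X Lstar)ᵀ = X Lstar := by
    rw [hX]
    exact transpose_tsum_pow_mul_mul_transpose_pow
      (by simp [Matrix.transpose_mul, hQt, hRt, Matrix.mul_assoc])
  have hdiff := lyapunov_sub_eq hRt hXt (hXeq L hL) (hXeq Lstar hLstarS) hLstarOpt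
  refine ⟨hdiff, ?_⟩
  rw [← trace_mul_eq_of_lyapunov hYeq hdiff, hJ, hJ, Matrix.sub_mul, Matrix.trace_sub,
    Matrix.mul_assoc, Matrix.mul_assoc]
  ring
end
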